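/- Let p be a prime with p ≡ 1 (mod 4), and write p = c² + d² with c, d ∈ ℤ and d even. Let a be an integer with p ∤ (16a² + 1). Then ∑_{k=0}^{(p−1)/4} C(4k,2k)·(−a²)^k ≡ (c − 4ad | 16a² + 1) (mod p) if the Legendre symbol (16a² + 1|p) = 1, where (c − 4ad | 16a² + 1) is the Jacobi symbol; and ∑_{k=0}^{(p−1)/4} C(4k,2k)·(−a²)^k ≡ 0 (mod p) if (16a² + 1|p) = −1. -/

import Mathlib

theorem Nat.cast_centralBinom_zmod {p n : ℕ} [Fact p.Prime] (hn : p = 2 * n + 1) {j : ℕ}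
    (hj : j ≤ n) : (Nat.centralBinom j : ZMod p) = (-4) ^ j * (n.choose j : ZMod p) := by
  induction j with
  | zero => simp
  | succ j ih =>
    have hp0 : (2 * (n : ZMod p) + 1) = 0 := by
      have : ((2 * n + 1 : ℕ) : ZMod p) = 0 := by rw [← hn]; exact ZMod.natCast_self p
      exact_mod_cast this
    have hj0 : ((j : ZMod p) + 1) ≠ 0 := by
      intro h
      have h' : ((j + 1 : ℕ) : ZMod p) = 0 := by exact_mod_cast h
      rw [ZMod.natCast_eq_zero_iff] at h'
      have := Nat.le_of_dvd (by omega) h'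
      omega
    have h1 : ((j : ZMod p) + 1) * (Nat.centralBinom (j + 1) : ZMod p)
        = 2 * (2 * j + 1) * Nat.centralBinom j := by
      exact_mod_cast congrArg (Nat.cast (R := ZMod p)) (Nat.succ_mul_centralBinom_succ j)
    have h2 : (n.choose (j + 1) : ZMod p) * ((j : ZMod p) + 1)
        = n.choose j * ((n : ZMod p) - j) := by
      have := congrArg (Nat.cast (R := ZMod p)) (Nat.choose_succ_right_eq n j)
      rwa [Nat.cast_mul, Nat.cast_mul, Nat.cast_sub (by omega), Nat.cast_succ] at this
    apply mul_left_cancel₀ hj0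
    rw [h1, ih (by omega), pow_succ]
    linear_combination (4 * (-4) ^ j) * h2 + 2 * (-4) ^ j * (n.choose j : ZMod p) * hp0

theorem Finset.sum_range_two_mul_succ {M : Type*} [AddCommMonoid M] (f : ℕ → M) (N : ℕ) :
    ∑ k ∈ Finset.range (2 * N + 1), f k
      = ∑ k ∈ Finset.range (N + 1), f (2 * k) + ∑ k ∈ Finset.range N, f (2 * k + 1) := by
  induction N with
  | zero => simp
  | succ N ih =>
    rw [show 2 * (N + 1) + 1 = 2 * N + 1 + 1 + 1 by ring, Finset.sum_range_succ,
      Finset.sum_range_succ, ih, Finset.sum_range_succ _ (N + 1),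
      Finset.sum_range_succ (fun k => f (2 * k + 1)) N,
      show 2 * N + 1 + 1 = 2 * (N + 1) by ring]
    ac_rfl

theorem one_add_pow_add_one_sub_pow {R : Type*} [CommRing R] (x : R) (N : ℕ) :
    (1 + x) ^ (2 * N) + (1 - x) ^ (2 * N)
      = 2 * ∑ k ∈ Finset.range (N + 1), ((2 * N).choose (2 * k) : R) * (x ^ 2) ^ k := by
  rw [add_comm 1 x, sub_eq_neg_add, add_pow, add_pow, Finset.sum_range_two_mul_succ,
    Finset.sum_range_two_mul_succ]
  have h : ∀ k, (-x) ^ (2 * k + 1) = - x ^ (2 * k + 1) := fun k => Odd.neg_pow ⟨k, rfl⟩ x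
  have h' : ∀ k, (-x) ^ (2 * k) = x ^ (2 * k) := fun k => Even.neg_pow ⟨k, by ring⟩ x
  simp only [h, h', one_pow, mul_one, neg_mul, Finset.sum_neg_distrib, pow_mul,
    Finset.mul_sum]
  rw [add_add_add_comm, add_neg_cancel, add_zero, ← two_mul, Finset.mul_sum]
  exact Finset.sum_congr rfl fun k _ => by ring

theorem jacobiSym.quadratic_reciprocity_natAbs {e : ℤ} {m : ℕ} (he : Odd e) (hm : m % 4 = 1) :
    jacobiSym e m = jacobiSym m e.natAbs := by
  have hodd : Odd e.natAbs := Int.natAbs_odd.mpr he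
  rw [← jacobiSym.quadratic_reciprocity_one_mod_four' hodd hm]
  rcases Int.natAbs_eq e with h | h
  · rw [← h]
  · conv_lhs => rw [h]
    rw [jacobiSym.neg _ (Nat.odd_iff.mpr (by omega)), ZMod.χ₄_nat_one_mod_four hm, one_mul]

theorem jacobiSym_eq_one_of_eq_mul_add_sq {e f g : ℤ} {m : ℕ} (he : Odd e) (hm : m % 4 = 1)
    (h : (m : ℤ) = e * g + f ^ 2) (hef : IsCoprime f e) : jacobiSym e m = 1 := by
  rw [jacobiSym.quadratic_reciprocity_natAbs he hm, h]
  have hmod : (e * g + f ^ 2) % (e.natAbs : ℤ) = f ^ 2 % (e.natAbs : ℤ) := by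
    rw [Int.emod_emod_of_dvd _ dvd_rfl |>.symm, Int.add_emod,
      Int.emod_eq_zero_of_dvd (Int.natAbs_dvd.mpr (dvd_mul_right e g))]
    simp
  rw [jacobiSym.mod_left' hmod]
  apply jacobiSym.sq_one'
  simpa only [Int.gcd, Int.natAbs_natCast] using Int.isCoprime_iff_gcd_eq_one.mp hef

theorem isCoprime_of_prime_eq_sq_add_sq {p : ℕ} (hp : p.Prime) {c d : ℤ}
    (hcd : (p : ℤ) = c ^ 2 + d ^ 2) : IsCoprime c d := by
  rw [Int.isCoprime_iff_gcd_eq_one]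
  obtain ⟨u, hu⟩ := Int.gcd_dvd_left c d
  obtain ⟨v, hv⟩ := Int.gcd_dvd_right c d
  have h : ((Int.gcd c d : ℕ) : ℤ) * (Int.gcd c d : ℕ) ∣ (p : ℤ) :=
    ⟨u ^ 2 + v ^ 2, by linear_combination hcd + (c + Int.gcd c d * u) * hu + (d + Int.gcd c d * v) * hv⟩
  have h' : Int.gcd c d * Int.gcd c d ∣ p := by exact_mod_cast h
  exact Nat.isUnit_iff.mp (hp.prime.irreducible.squarefree _ h')

theorem stmt10 (p : ℕ) [Fact p.Prime] (hp : p % 4 = 1) (c d : ℤ)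
    (hcd : (p : ℤ) = c ^ 2 + d ^ 2) (hd : Even d) (a : ℤ)
    (ha : ¬ (p : ℤ) ∣ (16 * a ^ 2 + 1)) :
    (legendreSym p (16 * a ^ 2 + 1) = 1 →
      (∑ k ∈ Finset.range ((p - 1) / 4 + 1),
          (Nat.choose (4 * k) (2 * k) : ZMod p) * (-(a : ZMod p) ^ 2) ^ k)
        = (jacobiSym (c - 4 * a * d) (16 * a ^ 2 + 1).toNat : ZMod p)) ∧
    (legendreSym p (16 * a ^ 2 + 1) = -1 →
      (∑ k ∈ Finset.range ((p - 1) / 4 + 1),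
          (Nat.choose (4 * k) (2 * k) : ZMod p) * (-(a : ZMod p) ^ 2) ^ k) = 0) := by
  have hpp : p.Prime := Fact.out
  obtain ⟨N, hN⟩ : ∃ N, p = 4 * N + 1 := ⟨p / 4, by omega⟩
  have hN4 : (p - 1) / 4 = N := by omega
  have hp2 : p / 2 = 2 * N := by omega
  rw [hN4]
  have hcop : IsCoprime c d := isCoprime_of_prime_eq_sq_add_sq hpp hcd
  have hc : Odd c := by
    have : Odd (c ^ 2 + d ^ 2) := by rw [← hcd]; exact_mod_cast Nat.odd_iff.mpr (by omega)
    by_contra hc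
    rw [Int.not_odd_iff_even] at hc
    exact Int.not_odd_iff_even.mpr ((hc.pow_of_ne_zero two_ne_zero).add
      (hd.pow_of_ne_zero two_ne_zero)) this
  have hLc : legendreSym p c = 1 := by
    rw [jacobiSym.legendreSym.to_jacobiSym]
    exact jacobiSym_eq_one_of_eq_mul_add_sq hc hp (by rw [hcd]; ring) hcop.symm
  have hc0 : (c : ZMod p) ≠ 0 := by
    intro h
    rw [(legendreSym.eq_zero_iff p c).mpr h] at hLc
    exact absurd hLc (by norm_num)
  have hcdp : (c : ZMod p) ^ 2 + (d : ZMod p) ^ 2 = 0 := by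
    have : ((c ^ 2 + d ^ 2 : ℤ) : ZMod p) = 0 := by rw [← hcd]; simp
    exact_mod_cast this
  have hcn : (c : ZMod p) ^ (2 * N) = 1 := by
    rw [← hp2, ← legendreSym.eq_pow, hLc, Int.cast_one]
  have hsum : 2 * ∑ k ∈ Finset.range (N + 1),
      (Nat.choose (4 * k) (2 * k) : ZMod p) * (-(a : ZMod p) ^ 2) ^ k
      = (legendreSym p (c - 4 * a * d) : ZMod p) + (legendreSym p (c + 4 * a * d) : ZMod p) := by
    have hx2 : (-(4 * a * d / c) : ZMod p) ^ 2 = -16 * (a : ZMod p) ^ 2 := by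
      field_simp
      linear_combination 16 * (a : ZMod p) ^ 2 * hcdp
    have hx := one_add_pow_add_one_sub_pow (-(4 * a * d / c) : ZMod p) N
    rw [hx2] at hx
    have e1 : (1 + -(4 * a * d / c) : ZMod p) = (c - 4 * a * d) / c := by field_simp; ring
    have e2 : (1 - -(4 * a * d / c) : ZMod p) = (c + 4 * a * d) / c := by field_simp; ring
    rw [e1, e2, div_pow, div_pow, hcn, div_one, div_one] at hx
    rw [legendreSym.eq_pow, legendreSym.eq_pow, hp2]
    push_cast
    rw [hx]
    congr 1
    refine Finset.sum_congr rfl fun k hk => ?_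
    have hk' : 2 * k ≤ 2 * N := by have := Finset.mem_range.mp hk; omega
    have := Nat.cast_centralBinom_zmod (p := p) (n := 2 * N) (by omega) hk'
    rw [Nat.centralBinom, ← mul_assoc, show 2 * 2 = 4 from rfl, pow_mul] at this
    rw [this, show (-16 * (a : ZMod p) ^ 2) = (-4) ^ 2 * (-(a : ZMod p) ^ 2) by ring, mul_pow]
    ring
  have h2 : (2 : ZMod p) ≠ 0 := by
    intro h
    have h' : ((2 : ℕ) : ZMod p) = 0 := by exact_mod_cast h
    rw [ZMod.natCast_eq_zero_iff] at h'
    have := Nat.le_of_dvd (by norm_num) h'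
    have := hpp.two_le
    omega
  have hprod : legendreSym p (c - 4 * a * d) * legendreSym p (c + 4 * a * d)
      = legendreSym p (16 * a ^ 2 + 1) := by
    have hR : legendreSym p (16 * a ^ 2 + 1) = legendreSym p (c * c * (16 * a ^ 2 + 1)) := by
      rw [legendreSym.mul, legendreSym.mul, hLc, one_mul, one_mul]
    rw [← legendreSym.mul, hR, legendreSym.mod, legendreSym.mod p (c * c * _)]
    congr 1
    apply Int.ModEq.symm
    rw [Int.modEq_iff_dvd, hcd]
    exact ⟨-(16 * a ^ 2), by ring⟩
  constructor
  · intro h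
    rw [h] at hprod
    have heq : legendreSym p (c - 4 * a * d) = legendreSym p (c + 4 * a * d) := by
      rcases Int.mul_eq_one_iff_eq_one_or_neg_one.mp hprod with ⟨h1, h2⟩ | ⟨h1, h2⟩ <;>
        rw [h1, h2]
    have hS : ∑ k ∈ Finset.range (N + 1),
        (Nat.choose (4 * k) (2 * k) : ZMod p) * (-(a : ZMod p) ^ 2) ^ k
        = (legendreSym p (c - 4 * a * d) : ZMod p) := by
      apply mul_left_cancel₀ h2
      rw [hsum, ← heq]
      ring
    rw [hS]
    congr 1
    obtain ⟨m, hm⟩ : ∃ m : ℕ, (16 * a ^ 2 + 1 : ℤ) = m :=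
      ⟨_, (Int.toNat_of_nonneg (by positivity)).symm⟩
    have hm4 : m % 4 = 1 := by omega
    rw [hm, Int.toNat_natCast, jacobiSym.legendreSym.to_jacobiSym]
    have he : Odd (c - 4 * a * d) :=
      hc.sub_even (Even.mul_left hd _)
    have hpm : IsCoprime (p : ℤ) (16 * a ^ 2 + 1) :=
      (Nat.prime_iff_prime_int.mp hpp).coprime_iff_not_dvd.mpr ha
    have hfe : IsCoprime (4 * a * c + d) (c - 4 * a * d) := by
      obtain ⟨r, s, hrs⟩ := hcop
      obtain ⟨u, v, huv⟩ := hpm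
      rw [hcd] at huv
      have hgen : 16 * a ^ 2 + 1
          = r * (4 * a * (4 * a * c + d) + (c - 4 * a * d))
            + s * ((4 * a * c + d) - 4 * a * (c - 4 * a * d)) := by
        linear_combination (-(16 * a ^ 2 + 1)) * hrs
      refine ⟨(u * d ^ 2 + v) * (4 * a * r + s),
        u * (c + 4 * a * d) + (u * d ^ 2 + v) * (r - 4 * a * s), ?_⟩
      linear_combination huv - (u * d ^ 2 + v) * hgen
    have hmul : jacobiSym (c - 4 * a * d) (p * m) = 1 := by
      refine jacobiSym_eq_one_of_eq_mul_add_sq (g := c - 4 * a * d) he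
        (by rw [Nat.mul_mod, hp, hm4]) ?_ hfe
      push_cast
      rw [hcd, ← hm]
      ring
    have : NeZero m := ⟨by omega⟩
    have : NeZero p := ⟨hpp.ne_zero⟩
    rw [jacobiSym.mul_right] at hmul
    rcases Int.mul_eq_one_iff_eq_one_or_neg_one.mp hmul with ⟨h1, h2⟩ | ⟨h1, h2⟩ <;> rw [h1, h2]
  · intro h
    rw [h] at hprod
    have hneg : legendreSym p (c + 4 * a * d) = -legendreSym p (c - 4 * a * d) := by
      rcases Int.mul_eq_neg_one_iff_eq_one_or_neg_one.mp hprod with ⟨h1, h2⟩ | ⟨h1, h2⟩ <;>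
        rw [h1, h2] <;> norm_num
    apply mul_left_cancel₀ h2
    rw [hsum, hneg]
    push_cast
    ring
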